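/- Let G be a balanced bipartite graph of order 2n, where n ≥ 2k+2 and k is a natural number. If e(G) ≥ (n−k−1)n + k + 2, then G contains cycles of all even lengths from 4 up to its circumference c(G), i.e. for every integer ℓ with 4 ≤ 2ℓ' ≤ c(G) (2ℓ' even), G contains a cycle of length 2ℓ'. -/

import Mathlib

namespace SimpleGraph

variable {V : Type*} (G : SimpleGraph V)

/-- There is a path of length `L` from `u` to `v` all of whose vertices lie in `S`. -/
def HasPathIn (u v : V) (L : ℕ) (S : Set V) : Prop :=
  ∃ p : ℕ → V, p 0 = u ∧ p L = v ∧ (∀ i < L, G.Adj (p i) (p (i + 1))) ∧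
    (∀ i ≤ L, ∀ j ≤ L, p i = p j → i = j) ∧ ∀ i ≤ L, p i ∈ S

/-- `f` runs periodically around a cycle of length `N`. The value `N = 2`, that is, running back
and forth along an edge, is allowed. -/
structure IsCyclicSeq (f : ℕ → V) (N : ℕ) : Prop where
  periodic : Function.Periodic f N
  adj : ∀ i, G.Adj (f i) (f (i + 1))
  ne : ∀ i j, i < j → j < i + N → f i ≠ f j

variable {G} {u v w z : V} {L L' N m : ℕ} {S S' : Set V} {f : ℕ → V}

lemma HasPathIn.single (h : u ∈ S) : G.HasPathIn u u 0 S :=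
  ⟨fun _ => u, rfl, rfl, by simp, by simp, by simp [h]⟩

lemma HasPathIn.mono (h : G.HasPathIn u v L S) (hS : S ⊆ S') : G.HasPathIn u v L S' := by
  obtain ⟨p, h0, hL, ha, hi, hs⟩ := h
  exact ⟨p, h0, hL, ha, hi, fun i hiL => hS (hs i hiL)⟩

lemma HasPathIn.reverse (h : G.HasPathIn u v L S) : G.HasPathIn v u L S := by
  obtain ⟨p, h0, hL, ha, hi, hs⟩ := h
  refine ⟨fun i => p (L - i), by simpa using hL, by simpa using h0, ?_, ?_, ?_⟩
  · intro i hiL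
    have := ha (L - (i + 1)) (by omega)
    rw [show L - (i + 1) + 1 = L - i by omega] at this
    exact this.symm
  · intro i hiL j hjL h
    have := hi (L - i) (by omega) (L - j) (by omega) h
    omega
  · intro i hiL
    exact hs _ (by omega)

lemma HasPathIn.append (h : G.HasPathIn u v L S) (hvw : G.Adj v w) (h' : G.HasPathIn w z L' S')
    (hd : Disjoint S S') : G.HasPathIn u z (L + L' + 1) (S ∪ S') := by
  obtain ⟨p, h0, hL, ha, hi, hs⟩ := h
  obtain ⟨q, h0', hL', ha', hi', hs'⟩ := h'
  have hne : ∀ i ≤ L, ∀ j ≤ L', p i ≠ q j := fun i hiL j hj h =>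
    Set.disjoint_left.1 hd (hs i hiL) (h ▸ hs' j hj)
  refine ⟨fun i => if i ≤ L then p i else q (i - (L + 1)), by simpa using h0, ?_, ?_, ?_, ?_⟩
  · simp only [show ¬ (L + L' + 1 ≤ L) by omega, if_false]
    rw [show L + L' + 1 - (L + 1) = L' by omega, hL']
  · intro i hiL
    rcases lt_trichotomy i L with h | h | h
    · simp only [show i ≤ L by omega, show i + 1 ≤ L by omega, if_true]
      exact ha i h
    · subst h
      simpa [hL, h0'] using hvw
    · simp only [show ¬ i ≤ L by omega, show ¬ i + 1 ≤ L by omega, if_false]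
      have := ha' (i - (L + 1)) (by omega)
      rwa [show i - (L + 1) + 1 = i + 1 - (L + 1) by omega] at this
  · intro i hiL j hjL h
    by_cases h1 : i ≤ L <;> by_cases h2 : j ≤ L <;> simp only [h1, h2, if_true, if_false] at h
    · exact hi i h1 j h2 h
    · exact absurd h (hne i h1 _ (by omega))
    · exact absurd h.symm (hne j h2 _ (by omega))
    · have := hi' _ (by omega) _ (by omega) h
      omega
  · intro i hiL
    by_cases h1 : i ≤ L <;> simp only [h1, if_true, if_false]
    · exact Or.inl (hs i h1)
    · exact Or.inr (hs' _ (by omega))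

lemma hasPathIn_segment (a n : ℕ) (ha : ∀ i < n, G.Adj (f (a + i)) (f (a + i + 1)))
    (hi : ∀ i j, a ≤ i → i < j → j ≤ a + n → f i ≠ f j) :
    G.HasPathIn (f a) (f (a + n)) n (f '' Set.Icc a (a + n)) := by
  refine ⟨fun i => f (a + i), rfl, rfl, fun i h => ha i h, ?_, ?_⟩
  · intro i hin j hjn h
    by_contra hne
    rcases lt_or_gt_of_ne hne with h' | h'
    · exact hi _ _ (by omega) (by omega) (by omega) h
    · exact hi _ _ (by omega) (by omega) (by omega) h.symm
  · intro i hin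
    exact ⟨a + i, ⟨by omega, by omega⟩, rfl⟩

namespace IsCyclicSeq

lemma shift (h : G.IsCyclicSeq f N) (a : ℕ) : G.IsCyclicSeq (fun i => f (i + a)) N where
  periodic i := by
    have := h.periodic (i + a)
    simp only at this ⊢
    rw [← this]
    congr 1
    omega
  adj i := by
    have := h.adj (i + a)
    rwa [show i + a + 1 = i + 1 + a by omega] at this
  ne i j hij hj := h.ne _ _ (by omega) (by omega)

lemma segment (h : G.IsCyclicSeq f N) (a n : ℕ) (hn : n < N) :
    G.HasPathIn (f a) (f (a + n)) n (f '' Set.Icc a (a + n)) :=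
  hasPathIn_segment a n (fun _ _ => h.adj _) fun i j h1 h2 h3 => h.ne i j h2 (by omega)

lemma disjoint_image (h : G.IsCyclicSeq f N) {a b c d : ℕ} (hbc : b < c) (hd : d < a + N) :
    Disjoint (f '' Set.Icc a b) (f '' Set.Icc c d) := by
  rw [Set.disjoint_left]
  rintro _ ⟨i, ⟨h1, h2⟩, rfl⟩ ⟨j, ⟨h3, h4⟩, h5⟩
  exact h.ne i j (by omega) (by omega) h5.symm

end IsCyclicSeq

lemma HasPathIn.exists_isCyclicSeq (h : G.HasPathIn u v L S) (hL : 1 ≤ L) (hvu : G.Adj v u) :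
    ∃ f, G.IsCyclicSeq f (L + 1) ∧ ∀ i, f i ∈ S := by
  obtain ⟨p, h0, hL, ha, hi, hs⟩ := h
  have hlt : ∀ i, i % (L + 1) < L + 1 := fun i => Nat.mod_lt _ (by omega)
  refine ⟨fun i => p (i % (L + 1)), ⟨?_, ?_, ?_⟩, ?_⟩
  · intro i
    simp
  · intro i
    have := hlt i
    by_cases h : i % (L + 1) = L
    · have h' : (i + 1) % (L + 1) = 0 := by
        rw [Nat.add_mod, h]
        rcases L with _ | L
        · omega
        · rw [Nat.mod_eq_of_lt (show 1 < L + 1 + 1 by omega), Nat.mod_self]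
      simpa [h, h', h0, hL] using hvu
    · have h' : (i + 1) % (L + 1) = i % (L + 1) + 1 := by
        rw [Nat.add_mod, Nat.mod_eq_of_lt (show 1 < L + 1 by omega), Nat.mod_eq_of_lt (by omega)]
      simp only [h']
      exact ha _ (by omega)
  · intro i j hij hj h
    have h1 := hi _ (Nat.le_of_lt_succ (hlt i)) _ (Nat.le_of_lt_succ (hlt j)) h
    have h2 : L + 1 ∣ j - i := (Nat.modEq_iff_dvd' hij.le).1 h1
    have := Nat.le_of_dvd (by omega) h2
    omega
  · intro i
    exact hs _ (Nat.le_of_lt_succ (hlt i))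

lemma exists_walk_of_adj (p : ℕ → V) (L : ℕ) (ha : ∀ i < L, G.Adj (p i) (p (i + 1))) :
    ∃ q : G.Walk (p 0) (p L), q.length = L ∧ q.support = (List.range (L + 1)).map p := by
  induction L with
  | zero => exact ⟨.nil, rfl, by simp⟩
  | succ L ih =>
    obtain ⟨q, hq, hs⟩ := ih fun i hi => ha i (by omega)
    refine ⟨q.concat (ha L (by omega)), by simp [hq], ?_⟩
    rw [Walk.support_concat, hs, List.range_succ (n := L + 1)]
    simp

lemma IsCyclicSeq.exists_isCycle (h : G.IsCyclicSeq f N) (hN : 3 ≤ N) :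
    ∃ (v : V) (w : G.Walk v v), w.IsCycle ∧ w.length = N := by
  obtain ⟨q, hq, hs⟩ := exists_walk_of_adj f (N - 1) fun i _ => h.adj i
  have hadj : G.Adj (f (N - 1)) (f 0) := by
    have h1 := h.adj (N - 1)
    have h2 := h.periodic 0
    rwa [show N - 1 + 1 = 0 + N by omega, h2] at h1
  have hp : q.IsPath := by
    rw [Walk.isPath_def, hs]
    refine List.Nodup.map_on ?_ List.nodup_range
    intro i hi j hj hij
    rw [List.mem_range] at hi hj
    by_contra hne
    rcases lt_or_gt_of_ne hne with h' | h'
    · exact h.ne _ _ h' (by omega) hij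
    · exact h.ne _ _ h' (by omega) hij.symm
  refine ⟨_, .cons hadj q, ?_, by simp [hq]; omega⟩
  rw [Walk.cons_isCycle_iff]
  refine ⟨hp, fun he => ?_⟩
  rw [Sym2.eq_swap] at he
  have := hp.length_eq_one_of_mem_edges he
  omega

lemma Walk.IsCycle.exists_isCyclicSeq {w : G.Walk v v} (h : w.IsCycle) :
    ∃ f, G.IsCyclicSeq f w.length := by
  have h3 := h.three_le_length
  have hP : G.HasPathIn v (w.getVert (w.length - 1)) (w.length - 1) Set.univ := by
    refine ⟨w.getVert, by simp, rfl, ?_, ?_, by simp⟩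
    · intro i hi
      exact w.adj_getVert_succ (by omega)
    · intro i hi j hj hij
      exact h.getVert_injOn' (by simpa using hi) (by simpa using hj) hij
  obtain ⟨f, hf, -⟩ := hP.exists_isCyclicSeq (by omega) (by
    have := w.adj_getVert_succ (i := w.length - 1) (by omega)
    rwa [show w.length - 1 + 1 = w.length by omega, w.getVert_length] at this)
  rw [show w.length - 1 + 1 = w.length by omega] at hf
  exact ⟨f, hf⟩

lemma of_periodic_of_step {q : ℕ → Prop} (hq : Function.Periodic q (2 * m)) {e j : ℕ} (hm : 0 < m)
    (hqj : q j) (hj : j % 2 = e) (hall : ∀ i, q (i + 2) → q i) {i : ℕ} (hi : i % 2 = e) : q i := by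
  have hdown : ∀ k i, q (i + 2 * k) → q i := by
    intro k
    induction k with
    | zero => exact fun i h => h
    | succ k ih => exact fun i h => ih i (hall _ h)
  have hup : ∀ k, q (j + k * (2 * m)) := by
    intro k
    have := hq.nat_mul k j
    simp only [Nat.cast_id] at this
    rwa [this]
  refine hdown ((j + i * (2 * m) - i) / 2) i ?_
  have h1 : i ≤ i * (2 * m) := Nat.le_mul_of_pos_right _ (by omega)
  have h2 : i * (2 * m) % 2 = 0 := by
    rw [show i * (2 * m) = 2 * (i * m) by ring]
    omega
  have := hup i
  rwa [show i + 2 * ((j + i * (2 * m) - i) / 2) = j + i * (2 * m) by omega]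

section Count

variable {p q r : ℕ → Prop} [DecidablePred p] [DecidablePred q] [DecidablePred r]

lemma count_comp_add_of_periodic (hp : Function.Periodic p N) (s : ℕ) :
    Nat.count (fun i => p (i + s)) N = Nat.count p N := by
  have h1 := Nat.count_add p s N
  have h2 := Nat.count_add p N s
  have h3 : Nat.count (fun k => p (N + k)) s = Nat.count p s := by
    simp only [Nat.count_eq_card_filter_range]
    congr 1
    refine Finset.filter_congr fun k _ => ?_
    rw [add_comm, hp k]
  have h4 : Nat.count (fun i => p (i + s)) N = Nat.count (fun k => p (s + k)) N := by
    simp only [Nat.count_eq_card_filter_range, add_comm]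
  rw [add_comm s N] at h1
  omega

lemma count_add_count_le (hpr : ∀ i, p i → r i) (hqr : ∀ i, q i → r i) (hpq : ∀ i, p i → ¬ q i) :
    Nat.count p N + Nat.count q N ≤ Nat.count r N := by
  simp only [Nat.count_eq_card_filter_range]
  rw [← Finset.card_union_of_disjoint]
  · refine Finset.card_le_card fun i hi => ?_
    simp only [Finset.mem_union, Finset.mem_filter] at hi ⊢
    rcases hi with hi | hi
    · exact ⟨hi.1, hpr i hi.2⟩
    · exact ⟨hi.1, hqr i hi.2⟩
  · rw [Finset.disjoint_left]
    intro i hi hi'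
    rw [Finset.mem_filter] at hi hi'
    exact hpq i hi.2 hi'.2

lemma count_mod_two_eq (e m : ℕ) (he : e < 2) : Nat.count (fun i => i % 2 = e) (2 * m) = m := by
  induction m with
  | zero => rfl
  | succ m ih =>
    rw [show 2 * (m + 1) = 2 * m + 1 + 1 by ring, Nat.count_succ, Nat.count_succ, ih]
    have : e = 0 ∨ e = 1 := by omega
    rcases this with rfl | rfl <;> simp [Nat.add_mod]

lemma two_mul_count_le (hp : Function.Periodic p (2 * m)) {e s : ℕ} (he : e < 2)
    (hpe : ∀ i, p i → i % 2 = e) (hs : s % 2 = 0) (hps : ∀ i, p i → ¬ p (i + s)) :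
    2 * Nat.count p (2 * m) ≤ m := by
  have h := count_add_count_le (N := 2 * m) (p := p) (q := fun i => p (i + s))
    (r := fun i => i % 2 = e) hpe (fun i hi => by have := hpe _ hi; omega) hps
  rw [count_comp_add_of_periodic hp, count_mod_two_eq e m he] at h
  omega

open scoped Classical in
/-- If a nonempty set `p` of odd residues and a nonempty set `q` of even residues modulo `2m` are
such that the translates of `p` by `1, 3, …, 2t - 1` avoid `q`, then `|p| + |q| ≤ m + 1 - t`. -/
lemma count_add_count_add_le (hpe : ∀ i, p i → i % 2 = 1)
    (hp0 : ∃ i, p i) {t : ℕ} (ht : 1 ≤ t) (hq : Function.Periodic q (2 * m))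
    (hqe : ∀ i, q i → i % 2 = 0) (hq0 : ∃ i, q i) (hm : 0 < m)
    (hpq : ∀ i, p i → ∀ s < t, ¬ q (i + 1 + 2 * s)) :
    Nat.count p (2 * m) + Nat.count q (2 * m) + t ≤ m + 1 := by
  induction t, ht using Nat.le_induction generalizing q with
  | base =>
    have h := count_add_count_le (N := 2 * m) (p := p) (q := fun i => q (i + 1))
      (r := fun i => i % 2 = 1) hpe (fun i hi => by have := hqe _ hi; omega)
      fun i hi => hpq i hi 0 one_pos
    rw [count_comp_add_of_periodic hq, count_mod_two_eq 1 m one_lt_two] at h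
    omega
  | succ t ht ih =>
    have hstep : ∃ i, q (i + 2) ∧ ¬ q i := by
      by_contra! hall
      obtain ⟨i, hi⟩ := hp0
      obtain ⟨j, hj⟩ := hq0
      have := hpe i hi
      exact hpq i hi 0 (by omega) (of_periodic_of_step hq hm hj (hqe j hj) hall (by omega))
    obtain ⟨j, hj, hj'⟩ := hstep
    have hq' : Function.Periodic (fun i => q i ∨ q (i + 2)) (2 * m) := by
      intro i
      simp only [hq i, show i + 2 * m + 2 = i + 2 + 2 * m by ring, hq (i + 2)]
    have h := ih hq' (fun i hi => by
        rcases hi with hi | hi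
        · exact hqe i hi
        · have := hqe _ hi
          omega) ⟨j, Or.inr hj⟩ (by
        intro i hi s hs h
        rcases h with h | h
        · exact hpq i hi s (by omega) h
        · exact hpq i hi (s + 1) (by omega) h)
    have hlt : Nat.count q (2 * m) < Nat.count (fun i => q i ∨ q (i + 2)) (2 * m) := by
      simp only [Nat.count_eq_card_filter_range]
      refine Finset.card_lt_card (Finset.ssubset_iff_of_subset ?_ |>.2 ⟨j % (2 * m), ?_, ?_⟩)
      · intro i hi
        rw [Finset.mem_filter] at hi ⊢
        exact ⟨hi.1, Or.inl hi.2⟩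
      · rw [Finset.mem_filter, Finset.mem_range]
        exact ⟨Nat.mod_lt _ (by omega), (hq'.map_mod_nat j).symm ▸ Or.inr hj⟩
      · rw [Finset.mem_filter, hq.map_mod_nat j]
        exact fun h => hj' h.2
    omega

end Count

variable {X : Set V}

lemma IsCyclicSeq.mem_iff (h : G.IsCyclicSeq f N) (hb : ∀ u v, G.Adj u v → (u ∈ X ↔ v ∉ X))
    (i : ℕ) : (f i ∈ X ↔ f 0 ∈ X) ↔ i % 2 = 0 := by
  induction i with
  | zero => simp
  | succ i ih =>
    have := hb _ _ (h.adj i)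
    have h2 : (i + 1) % 2 = 0 ↔ ¬ i % 2 = 0 := by omega
    rw [h2, ← ih]
    tauto

lemma IsCyclicSeq.even (h : G.IsCyclicSeq f N) (hb : ∀ u v, G.Adj u v → (u ∈ X ↔ v ∉ X)) :
    N % 2 = 0 := by
  rw [← h.mem_iff hb]
  have := h.periodic 0
  rw [zero_add] at this
  rw [this]

lemma IsCyclicSeq.periodic_adj (h : G.IsCyclicSeq f N) (v : V) :
    Function.Periodic (fun i => G.Adj v (f i)) N := by
  intro i
  simp only [h.periodic i]

open scoped Classical in
/-- On a cycle of length `2m` in a bipartite graph without cycles of length `2ℓ`, two consecutive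
vertices send at most `m + 1` edges to the cycle. -/
lemma IsCyclicSeq.count_add_count_le (h : G.IsCyclicSeq f (2 * m))
    (hb : ∀ u v, G.Adj u v → (u ∈ X ↔ v ∉ X)) {ℓ : ℕ} (hℓ : 2 ≤ ℓ) (hℓm : ℓ < m)
    (hno : ∀ f, ¬ G.IsCyclicSeq f (2 * ℓ)) :
    Nat.count (fun i => G.Adj (f 0) (f i)) (2 * m) +
      Nat.count (fun i => G.Adj (f 1) (f i)) (2 * m) ≤ m + 1 := by
  have hp : ∀ i, G.Adj (f 0) (f i) → i % 2 = 1 := by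
    intro i hi
    have h1 := h.mem_iff hb i
    have h2 := hb _ _ hi
    have : ¬ i % 2 = 0 := by rw [← h1]; tauto
    omega
  have hq : ∀ i, G.Adj (f 1) (f i) → i % 2 = 0 := by
    intro i hi
    have h1 := h.mem_iff hb i
    have h2 := hb _ _ hi
    have h3 := hb _ _ (h.adj 0)
    rw [← h1]
    tauto
  -- chords `f 0 f j` and `f 1 f j'` with `j' < j` closing up to length `2ℓ`
  have hA : ∀ j j', G.Adj (f 0) (f j) → G.Adj (f 1) (f j') → 2 ≤ j' → j < 2 * m →
      j + 3 = j' + 2 * ℓ → False := by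
    intro j j' hj hj' h2 hjm hjj
    have P1 := h.segment 0 1 (by omega)
    have P2 := h.segment j' (j - j') (by omega)
    rw [show j' + (j - j') = j by omega] at P2
    obtain ⟨g, hg, -⟩ := (P1.append hj' P2 (h.disjoint_image (by omega) (by omega))).exists_isCyclicSeq
      (by omega) hj.symm
    rw [show 1 + (j - j') + 1 + 1 = 2 * ℓ by omega] at hg
    exact hno g hg
  have hB : ∀ j j', G.Adj (f 0) (f j) → G.Adj (f 1) (f j') → 1 ≤ j → j < j' → j' < 2 * m →
      j + 2 * m + 1 = j' + 2 * ℓ → False := by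
    intro j j' hj hj' h1 hjj' hjm hjj
    have P1 := (h.segment 1 (j - 1) (by omega)).reverse
    rw [show 1 + (j - 1) = j by omega] at P1
    have P2 := h.segment j' (2 * m - j') (by omega)
    rw [show j' + (2 * m - j') = 2 * m by omega] at P2
    have h0 : f (2 * m) = f 0 := by simpa using h.periodic 0
    obtain ⟨g, hg, -⟩ := (P1.append hj' P2 (h.disjoint_image (by omega) (by omega))).exists_isCyclicSeq
      (by omega) (h0 ▸ hj)
    rw [show j - 1 + (2 * m - j') + 1 + 1 = 2 * ℓ by omega] at hg
    exact hno g hg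
  set A := (Finset.range (2 * m)).filter fun i => G.Adj (f 0) (f i) with hAdef
  set B := (Finset.range (2 * m)).filter fun i => G.Adj (f 1) (f i) with hBdef
  set φ : ℕ → ℕ := fun j => if 2 * ℓ ≤ j + 1 then j + 3 - 2 * ℓ else j + 2 * m + 1 - 2 * ℓ with hφ
  set E := (Finset.range (m - 1)).image fun k => 2 * (k + 1) with hE
  have hcard : E.card ≤ m - 1 := by simpa using Finset.card_image_le (s := Finset.range (m - 1))
  have hmem : ∀ i, i % 2 = 0 → 2 ≤ i → i < 2 * m → i ∈ E := by
    intro i h1 h2 h3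
    rw [hE, Finset.mem_image]
    exact ⟨i / 2 - 1, by rw [Finset.mem_range]; omega, by omega⟩
  have hA' : ∀ j ∈ A.erase 1, G.Adj (f 0) (f j) ∧ j % 2 = 1 ∧ 3 ≤ j ∧ j < 2 * m := by
    intro j hj
    rw [Finset.mem_erase, hAdef, Finset.mem_filter, Finset.mem_range] at hj
    have := hp j hj.2.2
    exact ⟨hj.2.2, this, by omega, hj.2.1⟩
  have hB' : ∀ j ∈ B.erase 0, G.Adj (f 1) (f j) ∧ j % 2 = 0 ∧ 2 ≤ j ∧ j < 2 * m := by
    intro j hj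
    rw [Finset.mem_erase, hBdef, Finset.mem_filter, Finset.mem_range] at hj
    have := hq j hj.2.2
    exact ⟨hj.2.2, this, by omega, hj.2.1⟩
  have hφinj : ((A.erase 1).image φ).card = (A.erase 1).card := by
    refine Finset.card_image_of_injOn fun i hi j hj hij => ?_
    have h1 := hA' i hi
    have h2 := hA' j hj
    simp only [hφ] at hij
    split_ifs at hij <;> omega
  have hdisj : Disjoint ((A.erase 1).image φ) (B.erase 0) := by
    rw [Finset.disjoint_left]
    intro j' hj' hj''
    obtain ⟨j, hj, rfl⟩ := Finset.mem_image.1 hj'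
    have h1 := hA' j hj
    have h2 := hB' _ hj''
    by_cases hc : 2 * ℓ ≤ j + 1
    · exact hA j _ h1.1 h2.1 h2.2.2.1 h1.2.2.2 (by simp only [hφ, hc, if_true]; omega)
    · exact hB j _ h1.1 h2.1 (by omega) (by simp only [hφ, hc, if_false]; omega) h2.2.2.2
        (by simp only [hφ, hc, if_false]; omega)
  have hsub : (A.erase 1).image φ ∪ B.erase 0 ⊆ E := by
    intro j hj
    rcases Finset.mem_union.1 hj with hj | hj
    · obtain ⟨i, hi, rfl⟩ := Finset.mem_image.1 hj
      have h1 := hA' i hi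
      by_cases hc : 2 * ℓ ≤ i + 1 <;> refine hmem _ ?_ ?_ ?_ <;>
        simp only [hφ, hc, if_true, if_false] <;> omega
    · have h1 := hB' j hj
      exact hmem _ h1.2.1 h1.2.2.1 h1.2.2.2
  have h1 := Finset.card_le_card hsub
  rw [Finset.card_union_of_disjoint hdisj, hφinj] at h1
  have h2 := Finset.pred_card_le_card_erase (s := A) (a := 1)
  have h3 := Finset.pred_card_le_card_erase (s := B) (a := 0)
  simp only [Nat.count_eq_card_filter_range]
  change A.card + B.card ≤ m + 1
  omega

open scoped Classical in
/-- A vertex outside a cycle of length `2m` in a bipartite graph without cycles of length `2ℓ`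
sends at most `m / 2` edges to the cycle. -/
lemma IsCyclicSeq.two_mul_count_le (h : G.IsCyclicSeq f (2 * m))
    (hb : ∀ u v, G.Adj u v → (u ∈ X ↔ v ∉ X)) {ℓ : ℕ} (hℓ : 2 ≤ ℓ) (hℓm : ℓ < m)
    (hno : ∀ f, ¬ G.IsCyclicSeq f (2 * ℓ)) (hv : ∀ i, f i ≠ v) :
    2 * Nat.count (fun i => G.Adj v (f i)) (2 * m) ≤ m := by
  have hcls : ∃ e < 2, ∀ i, G.Adj v (f i) → i % 2 = e := by
    by_cases hc : v ∈ X ↔ f 0 ∈ X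
    · refine ⟨1, by omega, fun i hi => ?_⟩
      have h1 := h.mem_iff hb i
      have h2 := hb _ _ hi
      have : ¬ i % 2 = 0 := by rw [← h1]; tauto
      omega
    · refine ⟨0, by omega, fun i hi => ?_⟩
      have h1 := h.mem_iff hb i
      have h2 := hb _ _ hi
      rw [← h1]
      tauto
  obtain ⟨e, he, hcls⟩ := hcls
  refine SimpleGraph.two_mul_count_le (h.periodic_adj v) he hcls (s := 2 * ℓ - 2) (by omega) ?_
  intro i hi hi'
  have P := HasPathIn.single (G := G) (Set.mem_singleton v) |>.append hi
    (h.segment i (2 * ℓ - 2) (by omega)) (by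
      rw [Set.disjoint_singleton_left]
      rintro ⟨j, -, hj⟩
      exact hv j hj)
  obtain ⟨g, hg, -⟩ := P.exists_isCyclicSeq (by omega) hi'.symm
  rw [show 0 + (2 * ℓ - 2) + 1 + 1 = 2 * ℓ by omega] at hg
  exact hno g hg

open scoped Classical in
/-- Two vertices joined by a path with `2r` vertices outside a longest cycle of length `2m`. -/
lemma IsCyclicSeq.count_add_count_add_le (h : G.IsCyclicSeq f (2 * m))
    (hb : ∀ u v, G.Adj u v → (u ∈ X ↔ v ∉ X)) (hmax : ∀ g N, G.IsCyclicSeq g N → N ≤ 2 * m)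
    {ℓ r : ℕ} (hℓ : 2 ≤ ℓ) (hℓm : ℓ < m) (hno : ∀ f, ¬ G.IsCyclicSeq f (2 * ℓ))
    (hr : 1 ≤ r) (hrm : r ≤ m) (hP : G.HasPathIn u v (2 * r - 1) S) (hS : ∀ i, f i ∉ S)
    (hu : u ∈ X ↔ f 0 ∈ X) (hv : v ∈ X ↔ f 0 ∉ X) :
    2 * (Nat.count (fun i => G.Adj u (f i)) (2 * m) +
      Nat.count (fun i => G.Adj v (f i)) (2 * m)) + r ≤ 2 * m + 1 := by
  have huS : u ∈ S := by
    obtain ⟨p, h0, -, -, -, hs⟩ := hP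
    exact h0 ▸ hs 0 (by omega)
  have hvS : v ∈ S := by
    obtain ⟨p, -, h0, -, -, hs⟩ := hP
    exact h0 ▸ hs _ le_rfl
  have h1 := h.two_mul_count_le hb hℓ hℓm hno (v := u) fun i hi => hS i (hi ▸ huS)
  have h2 := h.two_mul_count_le hb hℓ hℓm hno (v := v) fun i hi => hS i (hi ▸ hvS)
  by_cases hu0 : ∃ i, G.Adj u (f i)
  swap
  · have : Nat.count (fun i => G.Adj u (f i)) (2 * m) = 0 := by
      rw [Nat.count_eq_card_filter_range, Finset.card_eq_zero, Finset.filter_eq_empty_iff]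
      exact fun i _ hi => hu0 ⟨i, hi⟩
    omega
  by_cases hv0 : ∃ i, G.Adj v (f i)
  swap
  · have : Nat.count (fun i => G.Adj v (f i)) (2 * m) = 0 := by
      rw [Nat.count_eq_card_filter_range, Finset.card_eq_zero, Finset.filter_eq_empty_iff]
      exact fun i _ hi => hv0 ⟨i, hi⟩
    omega
  have h3 := SimpleGraph.count_add_count_add_le (fun i hi => by
      have h1 := h.mem_iff hb i
      have h2 := hb _ _ hi
      have : ¬ i % 2 = 0 := by rw [← h1]; tauto
      omega) hu0 hr (h.periodic_adj v) (fun i hi => by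
      have h1 := h.mem_iff hb i
      have h2 := hb _ _ hi
      rw [← h1]
      tauto) hv0 (by omega) (by
    intro i hi s hs hi'
    have Q := h.segment (i + 1 + 2 * s) (2 * m - 1 - 2 * s) (by omega)
    have hend : f (i + 1 + 2 * s + (2 * m - 1 - 2 * s)) = f i := by
      rw [show i + 1 + 2 * s + (2 * m - 1 - 2 * s) = i + 2 * m by omega]
      exact h.periodic i
    rw [hend] at Q
    obtain ⟨g, hg, -⟩ := (hP.append hi' Q (by
      rw [Set.disjoint_left]
      rintro _ hx ⟨j, -, rfl⟩
      exact hS j hx)).exists_isCyclicSeq (by omega) hi.symm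
    have := hmax g _ hg
    omega)
  omega

open scoped Classical in
lemma exists_pair_or_isCyclicSeq_of_path {R₁ R₂ : Finset V} {r : ℕ}
    (h₁ : R₁.card = r) (h₂ : R₂.card = r) (hd : Disjoint R₁ R₂)
    (hR₁ : ∀ u v, G.Adj u v → u ∈ R₁ → v ∉ R₁) (hR₂ : ∀ u v, G.Adj u v → u ∈ R₂ → v ∉ R₂)
    {p : ℕ → V} (ha : ∀ i < L, G.Adj (p i) (p (i + 1)))
    (hi : ∀ i ≤ L, ∀ j ≤ L, p i = p j → i = j) (hs : ∀ i ≤ L, p i ∈ (R₁ ∪ R₂ : Set V))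
    (hmax : ∀ u v L', G.HasPathIn u v L' (R₁ ∪ R₂ : Set V) → L' ≤ L) (h0 : p 0 ∈ R₁) :
    (∃ x ∈ R₁, ∃ y ∈ R₂,
      (R₂.filter fun w => G.Adj x w).card + (R₁.filter fun w => G.Adj y w).card ≤ r) ∨
    ∃ g, G.IsCyclicSeq g (2 * r) ∧ ∀ i, g i ∈ (R₁ ∪ R₂ : Set V) := by
  have hseg : ∀ a n, a + n ≤ L → G.HasPathIn (p a) (p (a + n)) n (p '' Set.Icc a (a + n)) := by
    intro a n han
    refine hasPathIn_segment a n (fun i hin => ha _ (by omega)) fun i j h1 h2 h3 h => ?_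
    have := hi i (by omega) j (by omega) h
    omega
  have hsub : ∀ a b, b ≤ L → p '' Set.Icc a b ⊆ (R₁ ∪ R₂ : Set V) := by
    rintro a b hb _ ⟨i, ⟨-, hib⟩, rfl⟩
    exact hs i (by omega)
  have hdisj : ∀ a b c d, b < c → d ≤ L → Disjoint (p '' Set.Icc a b) (p '' Set.Icc c d) := by
    intro a b c d hbc hdL
    rw [Set.disjoint_left]
    rintro _ ⟨i, ⟨h1, h2⟩, rfl⟩ ⟨j, ⟨h3, h4⟩, h5⟩
    have := hi j (by omega) i (by omega) h5
    omega
  by_contra! hcon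
  obtain ⟨hpair, hcyc⟩ := hcon
  -- neighbours of the first vertex lie on the path
  have hon : ∀ w ∈ R₂, G.Adj (p 0) w → ∃ j, 1 ≤ j ∧ j ≤ L ∧ p j = w := by
    intro w hw haw
    by_contra! hne
    have hwp : ∀ j ≤ L, p j ≠ w := by
      intro j hj hjw
      rcases Nat.eq_zero_or_pos j with rfl | hpos
      · exact haw.ne hjw
      · exact hne j hpos hj hjw
    have P := HasPathIn.single (G := G) (Set.mem_singleton w) |>.append haw.symm
      (hseg 0 L (by omega)) (by
        rw [Set.disjoint_singleton_left]
        rintro ⟨j, ⟨-, hj⟩, hjw⟩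
        exact hwp j (by omega) hjw)
    have := hmax _ _ _ (P.mono (Set.union_subset (by simpa using Or.inr hw) (hsub _ _ (by omega))))
    omega
  have hcross : ∀ y ∈ R₂, ∃ j, 1 ≤ j ∧ j ≤ L ∧ G.Adj (p 0) (p j) ∧ G.Adj y (p (j - 1)) := by
    intro y hy
    have hlt := hpair (p 0) h0 y hy
    by_contra! hno
    have hpos : ∀ w ∈ R₂.filter (fun w => G.Adj (p 0) w), ∃ j, 1 ≤ j ∧ j ≤ L ∧ p j = w :=
      fun w hw => hon w (Finset.mem_filter.1 hw).1 (Finset.mem_filter.1 hw).2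
    choose! k hk1 hkL hk using hpos
    have hcard : ((R₂.filter fun w => G.Adj (p 0) w).image fun w => p (k w - 1)).card =
        (R₂.filter fun w => G.Adj (p 0) w).card := by
      refine Finset.card_image_of_injOn fun w hw w' hw' hww => ?_
      have h1 := hk1 w hw
      have h2 := hk1 w' hw'
      have h3 := hkL w hw
      have h4 := hkL w' hw'
      have := hi _ (by omega) _ (by omega) hww
      rw [← hk w hw, ← hk w' hw', show k w = k w' by omega]
    have hle : ((R₂.filter fun w => G.Adj (p 0) w).image (fun w => p (k w - 1)) ∪
        R₁.filter fun w => G.Adj y w).card ≤ R₁.card := by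
      refine Finset.card_le_card fun z hz => ?_
      rcases Finset.mem_union.1 hz with hz | hz
      · obtain ⟨w, hw, rfl⟩ := Finset.mem_image.1 hz
        have h1 := hk1 w hw
        have h3 := hkL w hw
        have h4 := ha (k w - 1) (by omega)
        rw [show k w - 1 + 1 = k w by omega, hk w hw] at h4
        rcases hs (k w - 1) (by omega) with h | h
        · exact h
        · exact absurd (Finset.mem_filter.1 hw).1 (hR₂ _ _ h4 h)
      · exact (Finset.mem_filter.1 hz).1
    rw [Finset.card_union_of_disjoint, hcard] at hle
    · omega
    · rw [Finset.disjoint_left]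
      intro z hz hz'
      obtain ⟨w, hw, rfl⟩ := Finset.mem_image.1 hz
      refine hno (k w) (hk1 w hw) (hkL w hw) ?_ (Finset.mem_filter.1 hz').2
      rw [hk w hw]
      exact (Finset.mem_filter.1 hw).2
  -- every vertex of `R₂` lies on the path, as otherwise a rotated path could be extended
  have hcov : ∀ y ∈ R₂, ∃ i ≤ L, p i = y := by
    intro y hy
    by_contra! hyp
    obtain ⟨j, hj1, hjL, hxj, hyj⟩ := hcross y hy
    have P1 := (hseg 0 (j - 1) (by omega)).reverse
    have P2 := hseg j (L - j) (by omega)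
    rw [show j + (L - j) = L by omega] at P2
    have hd12 := hdisj 0 (0 + (j - 1)) j L (by omega) le_rfl
    have P3 := P1.append hxj P2 hd12
    have hsub' : p '' Set.Icc 0 (0 + (j - 1)) ∪ p '' Set.Icc j L ⊆ p '' Set.Icc 0 L := by
      rintro _ (⟨i, ⟨-, hib⟩, rfl⟩ | ⟨i, ⟨-, hib⟩, rfl⟩)
      · exact ⟨i, ⟨by omega, by omega⟩, rfl⟩
      · exact ⟨i, ⟨by omega, by omega⟩, rfl⟩
    have hyj' : G.Adj y (p (0 + (j - 1))) := by rwa [zero_add]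
    have P := HasPathIn.single (G := G) (Set.mem_singleton y) |>.append hyj' (P3.mono hsub') (by
        rw [Set.disjoint_singleton_left]
        rintro ⟨j, ⟨-, hj⟩, hjw⟩
        exact hyp j (by omega) hjw)
    have := hmax _ _ _ (P.mono (Set.union_subset (by simpa using Or.inr hy) (hsub _ _ le_rfl)))
    omega
  have halt : ∀ i ≤ L, (i % 2 = 0 → p i ∈ R₁) ∧ (i % 2 = 1 → p i ∈ R₂) := by
    intro i
    induction i with
    | zero => exact fun _ => ⟨fun _ => h0, by omega⟩
    | succ i ih =>
      intro hiL
      have h := ih (by omega)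
      have h' := ha i (by omega)
      refine ⟨fun h2 => ?_, fun h2 => ?_⟩
      · rcases hs (i + 1) hiL with h3 | h3
        · exact h3
        · exact absurd h3 (hR₂ _ _ h' (h.2 (by omega)))
      · rcases hs (i + 1) hiL with h3 | h3
        · exact absurd h3 (hR₁ _ _ h' (h.1 (by omega)))
        · exact h3
  have hL1 : r ≤ (L + 1) / 2 := by
    have : R₂ ⊆ (Finset.range ((L + 1) / 2)).image fun k => p (2 * k + 1) := by
      intro y hy
      obtain ⟨i, hiL, rfl⟩ := hcov y hy
      rw [Finset.mem_image]
      have hodd : i % 2 = 1 := by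
        by_contra hc
        exact Finset.disjoint_left.1 hd ((halt i hiL).1 (by omega)) hy
      exact ⟨i / 2, by rw [Finset.mem_range]; omega, by congr 1; omega⟩
    have := (Finset.card_le_card this).trans Finset.card_image_le
    rwa [Finset.card_range, h₂] at this
  have hL2 : L / 2 + 1 ≤ r := by
    have hinj : ((Finset.range (L / 2 + 1)).image fun k => p (2 * k)).card = L / 2 + 1 := by
      rw [Finset.card_image_of_injOn, Finset.card_range]
      intro i hi' j hj' hij
      simp only [Finset.coe_range, Set.mem_Iio] at hi' hj'
      have := hi _ (by omega) _ (by omega) hij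
      omega
    rw [← hinj, ← h₁]
    refine Finset.card_le_card fun z hz => ?_
    obtain ⟨k, hk, rfl⟩ := Finset.mem_image.1 hz
    rw [Finset.mem_range] at hk
    exact (halt _ (by omega)).1 (by omega)
  obtain ⟨j, hj1, hjL, hxj, hyj⟩ := hcross (p L) ((halt L le_rfl).2 (by omega))
  have P1 := hseg 0 (j - 1) (by omega)
  have P2 := (hseg j (L - j) (by omega)).reverse
  rw [show j + (L - j) = L by omega] at P2
  have hyj' : G.Adj (p (0 + (j - 1))) (p L) := by rw [zero_add]; exact hyj.symm
  obtain ⟨g, hg, hgs⟩ := (P1.append hyj' P2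
    (hdisj 0 (0 + (j - 1)) j L (by omega) le_rfl)).exists_isCyclicSeq (by omega) hxj.symm
  rw [show j - 1 + (L - j) + 1 + 1 = 2 * r by omega] at hg
  obtain ⟨i, hgi⟩ := hcyc g hg
  exact hgi (Set.union_subset (hsub _ _ (by omega)) (hsub _ _ le_rfl) (hgs i))

open scoped Classical in
/-- A balanced bipartite graph on `2r` vertices has two vertices, one on each side, of degree sum at
most `r`, or it is Hamiltonian (a single edge counting as such). -/
lemma exists_pair_or_isCyclicSeq {R₁ R₂ : Finset V} {r : ℕ} (hr : 1 ≤ r)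
    (h₁ : R₁.card = r) (h₂ : R₂.card = r) (hd : Disjoint R₁ R₂)
    (hR₁ : ∀ u v, G.Adj u v → u ∈ R₁ → v ∉ R₁) (hR₂ : ∀ u v, G.Adj u v → u ∈ R₂ → v ∉ R₂) :
    (∃ x ∈ R₁, ∃ y ∈ R₂,
      (R₂.filter fun w => G.Adj x w).card + (R₁.filter fun w => G.Adj y w).card ≤ r) ∨
    ∃ g, G.IsCyclicSeq g (2 * r) ∧ ∀ i, g i ∈ (R₁ ∪ R₂ : Set V) := by
  have hbound : ∀ u v L, G.HasPathIn u v L (R₁ ∪ R₂ : Set V) → L ≤ (R₁ ∪ R₂).card := by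
    rintro u v L ⟨p, -, -, -, hi, hs⟩
    have : ((Finset.range (L + 1)).image p).card = L + 1 := by
      rw [Finset.card_image_of_injOn, Finset.card_range]
      intro i hi' j hj' hij
      simp only [Finset.coe_range, Set.mem_Iio] at hi' hj'
      exact hi i (by omega) j (by omega) hij
    have hle : ((Finset.range (L + 1)).image p).card ≤ (R₁ ∪ R₂).card := by
      refine Finset.card_le_card fun z hz => ?_
      obtain ⟨k, hk, rfl⟩ := Finset.mem_image.1 hz
      rw [Finset.mem_range] at hk
      have := hs k (by omega)
      simpa using this
    omega
  obtain ⟨x, hx⟩ : R₁.Nonempty := Finset.card_pos.1 (by omega)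
  let P : ℕ → Prop := fun L => ∃ u v, G.HasPathIn u v L (R₁ ∪ R₂ : Set V)
  have hP0 : P 0 := ⟨x, x, HasPathIn.single (Or.inl hx)⟩
  have hP := Nat.findGreatest_spec (P := P) (Nat.zero_le (R₁ ∪ R₂).card) hP0
  have hmax : ∀ u v L', G.HasPathIn u v L' (R₁ ∪ R₂ : Set V) →
      L' ≤ Nat.findGreatest P (R₁ ∪ R₂).card := fun u v L' h =>
    Nat.le_findGreatest (hbound _ _ _ h) ⟨u, v, h⟩
  obtain ⟨u, v, p, -, -, ha, hi, hs⟩ := hP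
  rcases hs 0 (by omega) with h0 | h0
  · exact exists_pair_or_isCyclicSeq_of_path h₁ h₂ hd hR₁ hR₂ ha hi hs hmax h0
  · rw [Set.union_comm] at hs hmax
    rcases exists_pair_or_isCyclicSeq_of_path h₂ h₁ hd.symm hR₂ hR₁ ha hi hs hmax h0 with h | h
    · obtain ⟨y, hy, x, hx, h⟩ := h
      exact Or.inl ⟨x, hx, y, hy, by omega⟩
    · rw [Set.union_comm] at h
      exact Or.inr h

open scoped Classical in
lemma sum_card_filter_adj_comm (S T : Finset V) :
    ∑ x ∈ S, (T.filter fun y => G.Adj x y).card = ∑ y ∈ T, (S.filter fun x => G.Adj y x).card := by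
  simp only [Finset.card_filter]
  rw [Finset.sum_comm]
  simp only [G.adj_comm]

open scoped Classical in
lemma sum_card_filter_adj_erase_le {S T : Finset V} {x y : V} (hx : x ∈ S) :
    ∑ u ∈ S, (T.filter fun w => G.Adj u w).card ≤
      (∑ u ∈ S.erase x, ((T.erase y).filter fun w => G.Adj u w).card) +
        ((T.filter fun w => G.Adj x w).card + (S.filter fun w => G.Adj y w).card) := by
  rw [← Finset.sum_erase_add _ _ hx]
  have h1 : ∀ u ∈ S.erase x, (T.filter fun w => G.Adj u w).card ≤
      ((T.erase y).filter fun w => G.Adj u w).card + if G.Adj y u then 1 else 0 := by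
    intro u _
    have hsub : (T.filter fun w => G.Adj u w) ⊆
        ((T.erase y).filter fun w => G.Adj u w) ∪ if G.Adj y u then {y} else ∅ := by
      intro w hw
      rw [Finset.mem_filter] at hw
      by_cases hwy : w = y
      · subst hwy
        simp [hw.2.symm]
      · simp [hw, hwy]
    refine (Finset.card_le_card hsub).trans ((Finset.card_union_le _ _).trans ?_)
    split_ifs <;> simp
  have h2 := Finset.sum_le_sum h1
  rw [Finset.sum_add_distrib, ← Finset.card_filter] at h2
  have h3 : ((S.erase x).filter fun w => G.Adj y w).card ≤ (S.filter fun w => G.Adj y w).card :=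
    Finset.card_le_card (Finset.filter_subset_filter _ (Finset.erase_subset _ _))
  omega

lemma sum_range_add_one_of_periodic {d : ℕ → ℕ} (hd : Function.Periodic d N) :
    ∑ i ∈ Finset.range N, d (i + 1) = ∑ i ∈ Finset.range N, d i := by
  have h1 := Finset.sum_range_succ d N
  have h2 := Finset.sum_range_succ' d N
  have h3 := hd 0
  rw [zero_add] at h3
  omega

open scoped Classical in
lemma IsCyclicSeq.sum_image (h : G.IsCyclicSeq f N) (d : V → ℕ) :
    ∑ v ∈ (Finset.range N).image f, d v = ∑ i ∈ Finset.range N, d (f i) := by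
  refine Finset.sum_image fun i hi j hj hij => ?_
  simp only [Finset.coe_range, Set.mem_Iio] at hi hj
  by_contra hne
  rcases lt_or_gt_of_ne hne with h' | h'
  · exact h.ne _ _ h' (by omega) hij
  · exact h.ne _ _ h' (by omega) hij.symm

open scoped Classical in
lemma IsCyclicSeq.card_image (h : G.IsCyclicSeq f N) : ((Finset.range N).image f).card = N := by
  have := h.sum_image fun _ => 1
  simpa using this

open scoped Classical in
lemma IsCyclicSeq.card_filter_image (h : G.IsCyclicSeq f N) (P : V → Prop) :
    (((Finset.range N).image f).filter P).card = Nat.count (fun i => P (f i)) N := by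
  rw [Finset.card_filter, h.sum_image, ← Finset.card_filter, Nat.count_eq_card_filter_range]

open scoped Classical in
lemma IsCyclicSeq.sum_count_le (h : G.IsCyclicSeq f (2 * m))
    (hb : ∀ u v, G.Adj u v → (u ∈ X ↔ v ∉ X)) {ℓ : ℕ} (hℓ : 2 ≤ ℓ) (hℓm : ℓ < m)
    (hno : ∀ f, ¬ G.IsCyclicSeq f (2 * ℓ)) :
    ∑ i ∈ Finset.range (2 * m), Nat.count (fun j => G.Adj (f i) (f j)) (2 * m) ≤ m * (m + 1) := by
  have hle : ∀ i ∈ Finset.range (2 * m), Nat.count (fun j => G.Adj (f i) (f j)) (2 * m) +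
      Nat.count (fun j => G.Adj (f (i + 1)) (f j)) (2 * m) ≤ m + 1 := by
    intro i _
    have := (h.shift i).count_add_count_le hb hℓ hℓm hno
    simp only [zero_add] at this
    rwa [count_comp_add_of_periodic (h.periodic_adj (f i)),
      count_comp_add_of_periodic (h.periodic_adj (f (1 + i))), add_comm 1 i] at this
  have hsum := Finset.sum_le_sum hle
  rw [Finset.sum_add_distrib, sum_range_add_one_of_periodic
    (d := fun i => Nat.count (fun j => G.Adj (f i) (f j)) (2 * m))
    (fun i => by simp only [h.periodic i]), Finset.sum_const, Finset.card_range, smul_eq_mul,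
    mul_assoc] at hsum
  omega

open scoped Classical in
/-- The number of edges meeting a balanced set `R₁ ∪ R₂` of `2r` vertices outside a longest cycle of
length `2m`, counting only edges to the cycle and edges inside the set. -/
lemma IsCyclicSeq.edges_outside_le (h : G.IsCyclicSeq f (2 * m))
    (hb : ∀ u v, G.Adj u v → (u ∈ X ↔ v ∉ X)) (hmax : ∀ g N, G.IsCyclicSeq g N → N ≤ 2 * m)
    {ℓ : ℕ} (hℓ : 2 ≤ ℓ) (hℓm : ℓ < m) (hno : ∀ f, ¬ G.IsCyclicSeq f (2 * ℓ)) (r : ℕ)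
    (R₁ R₂ : Finset V) (h₁ : R₁.card = r) (h₂ : R₂.card = r) (hX₁ : ∀ v ∈ R₁, v ∈ X)
    (hX₂ : ∀ v ∈ R₂, v ∉ X) (hf₁ : ∀ i, f i ∉ R₁) (hf₂ : ∀ i, f i ∉ R₂) :
    2 * ((∑ v ∈ R₁, Nat.count (fun i => G.Adj v (f i)) (2 * m)) +
      (∑ v ∈ R₂, Nat.count (fun i => G.Adj v (f i)) (2 * m)) +
      ∑ v ∈ R₁, (R₂.filter fun w => G.Adj v w).card) ≤ 2 * (r * m) + r * r + r := by
  induction r generalizing R₁ R₂ with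
  | zero =>
    rw [Finset.card_eq_zero] at h₁ h₂
    subst h₁ h₂
    simp
  | succ r ih =>
    have hd : Disjoint R₁ R₂ := Finset.disjoint_left.2 fun v h h' => hX₂ v h' (hX₁ v h)
    rcases exists_pair_or_isCyclicSeq (Nat.le_add_left 1 r) h₁ h₂ hd
      (fun u v huv hu hv => (hb u v huv).1 (hX₁ u hu) (hX₁ v hv))
      (fun u v huv hu hv => hX₂ u hu ((hb u v huv).2 (hX₂ v hv))) with
      ⟨x, hx, y, hy, hxy⟩ | ⟨g, hg, hgR⟩
    · have hI := ih (R₁.erase x) (R₂.erase y) (by rw [Finset.card_erase_of_mem hx, h₁]; rfl)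
        (by rw [Finset.card_erase_of_mem hy, h₂]; rfl)
        (fun v hv => hX₁ v (Finset.mem_of_mem_erase hv))
        (fun v hv => hX₂ v (Finset.mem_of_mem_erase hv))
        (fun i hi => hf₁ i (Finset.mem_of_mem_erase hi))
        (fun i hi => hf₂ i (Finset.mem_of_mem_erase hi))
      have h3 := sum_card_filter_adj_erase_le (G := G) (T := R₂) (y := y) hx
      have h4 := h.two_mul_count_le hb hℓ hℓm hno (v := x) fun i hi => hf₁ i (hi ▸ hx)
      have h5 := h.two_mul_count_le hb hℓ hℓm hno (v := y) fun i hi => hf₂ i (hi ▸ hy)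
      rw [← Finset.sum_erase_add _ _ hx, ← Finset.sum_erase_add R₂ _ hy]
      have e1 : (r + 1) * m = r * m + m := by ring
      have e2 : (r + 1) * (r + 1) = r * r + 2 * r + 1 := by ring
      omega
    · have hrm : r + 1 ≤ m := by
        have := hmax g _ hg
        omega
      have hfR : ∀ i, f i ∉ (R₁ ∪ R₂ : Set V) := by
        rintro i (hi | hi)
        · exact hf₁ i hi
        · exact hf₂ i hi
      have himg : (Finset.range (2 * (r + 1))).image g = R₁ ∪ R₂ := by
        refine Finset.eq_of_subset_of_card_le (fun z hz => ?_) ?_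
        · obtain ⟨k, -, rfl⟩ := Finset.mem_image.1 hz
          simpa using hgR k
        · rw [Finset.card_union_of_disjoint hd, hg.card_image]
          omega
      set d : V → ℕ := fun v => Nat.count (fun i => G.Adj v (f i)) (2 * m) with hdd
      have hle : ∀ i ∈ Finset.range (2 * (r + 1)),
          2 * (d (g i) + d (g (i + 1))) + (r + 1) ≤ 2 * m + 1 := by
        intro i _
        have hP := ((hg.segment (i + 1) (2 * (r + 1) - 1) (by omega)).mono
          (S' := (R₁ ∪ R₂ : Set V)) (by
            rintro _ ⟨j, -, rfl⟩
            exact hgR j)).reverse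
        rw [show i + 1 + (2 * (r + 1) - 1) = i + 2 * (r + 1) by omega, hg.periodic i] at hP
        have hadj := hb _ _ (hg.adj i)
        by_cases hc : g i ∈ X ↔ f 0 ∈ X
        · exact h.count_add_count_add_le hb hmax hℓ hℓm hno (by omega) hrm hP hfR hc (by tauto)
        · have := h.count_add_count_add_le hb hmax hℓ hℓm hno (by omega) hrm hP.reverse hfR
            (by tauto) (by tauto)
          rwa [add_comm (d (g i))]
      have hsum := Finset.sum_le_sum hle
      rw [Finset.sum_add_distrib, ← Finset.mul_sum, Finset.sum_add_distrib,
        sum_range_add_one_of_periodic (d := fun i => d (g i)) (fun i => by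
          simp only [hg.periodic i]), ← hg.sum_image, himg, Finset.sum_union hd,
        Finset.sum_const, Finset.sum_const, Finset.card_range, smul_eq_mul, smul_eq_mul] at hsum
      have he : ∑ v ∈ R₁, (R₂.filter fun w => G.Adj v w).card ≤ (r + 1) * (r + 1) := by
        refine (Finset.sum_le_card_nsmul _ _ (r + 1) fun v _ => ?_).trans (by simp [h₁])
        exact h₂ ▸ Finset.card_filter_le _ _
      have e1 : 2 * (r + 1) * (2 * m + 1) = 4 * ((r + 1) * m) + 2 * (r + 1) := by ring
      have e2 : 2 * (r + 1) * (r + 1) = 2 * ((r + 1) * (r + 1)) := by ring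
      change 2 * ((∑ v ∈ R₁, d v) + (∑ v ∈ R₂, d v) + _) ≤ _
      omega

/-- A balanced bipartite graph of order `2n` in which a longest cycle has length `2m > 2ℓ ≥ 4` while
there is no cycle of length `2ℓ` has at most `n (n + 1) / 2` edges. -/
theorem IsCyclicSeq.two_mul_ncard_edgeSet_le [Fintype V] {X Y : Finset V} {n : ℕ}
    (h : G.IsCyclicSeq f (2 * m)) (hpart : ∀ v, v ∈ Y ↔ v ∉ X) (hX : X.card = n) (hY : Y.card = n)
    (hb : ∀ u v, G.Adj u v → (u ∈ X ↔ v ∉ X)) (hmax : ∀ g N, G.IsCyclicSeq g N → N ≤ 2 * m)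
    {ℓ : ℕ} (hℓ : 2 ≤ ℓ) (hℓm : ℓ < m) (hno : ∀ f, ¬ G.IsCyclicSeq f (2 * ℓ)) :
    2 * G.edgeSet.ncard ≤ n * (n + 1) := by
  classical
  have hb' : ∀ u v, G.Adj u v → (u ∈ (X : Set V) ↔ v ∉ (X : Set V)) := by simpa using hb
  set C := (Finset.range (2 * m)).image f with hC
  have hfC : ∀ i, f i ∈ C := by
    intro i
    rw [hC, Finset.mem_image]
    exact ⟨i % (2 * m), Finset.mem_range.2 (Nat.mod_lt _ (by omega)), h.periodic.map_mod_nat i⟩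
  have hCd : ∀ v, (C.filter fun w => G.Adj v w).card =
      Nat.count (fun i => G.Adj v (f i)) (2 * m) := fun v => by
    convert h.card_filter_image fun w => G.Adj v w
  have hCX : (C ∩ X).card = m ∧ (C ∩ Y).card = m := by
    have key : ∀ Z : Finset V, (∃ e < 2, ∀ i, f i ∈ Z ↔ i % 2 = e) → (C ∩ Z).card = m := by
      rintro Z ⟨e, he, hZ⟩
      rw [← Finset.filter_mem_eq_inter]
      have := h.card_filter_image (· ∈ Z)
      simp only [hZ, Nat.count_eq_card_filter_range] at this
      rw [← count_mod_two_eq e m he, Nat.count_eq_card_filter_range]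
      convert this
    have h2 : ∀ i, (f i ∈ X ↔ f 0 ∈ X) ↔ i % 2 = 0 := h.mem_iff hb'
    by_cases h0 : f 0 ∈ X
    · refine ⟨key X ⟨0, by omega, fun i => ?_⟩, key Y ⟨1, by omega, fun i => ?_⟩⟩
      · rw [← h2]; tauto
      · rw [hpart, ← Nat.mod_two_ne_zero, ne_eq, ← h2]; tauto
    · refine ⟨key X ⟨1, by omega, fun i => ?_⟩, key Y ⟨0, by omega, fun i => ?_⟩⟩
      · rw [← Nat.mod_two_ne_zero, ne_eq, ← h2]; tauto
      · rw [hpart, ← h2]; tauto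
  have h₁ : (X \ C).card = n - m := by rw [Finset.card_sdiff, hCX.1, hX]
  have h₂ : (Y \ C).card = n - m := by rw [Finset.card_sdiff, hCX.2, hY]
  have hmn : m ≤ n := by
    rw [← hCX.1, ← hX]
    exact Finset.card_le_card Finset.inter_subset_right
  have hout := h.edges_outside_le hb' hmax hℓ hℓm hno (n - m) (X \ C) (Y \ C) h₁ h₂
    (fun v hv => by simpa using (Finset.mem_sdiff.1 hv).1)
    (fun v hv => by simpa using (hpart v).1 (Finset.mem_sdiff.1 hv).1)
    (fun i hi => (Finset.mem_sdiff.1 hi).2 (hfC i))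
    (fun i hi => (Finset.mem_sdiff.1 hi).2 (hfC i))
  have hin := h.sum_count_le hb' hℓ hℓm hno
  rw [← h.sum_image fun v => Nat.count (fun j => G.Adj v (f j)) (2 * m), ← hC] at hin
  have hd₁ : Disjoint C (X \ C) := Finset.disjoint_sdiff
  have hd₂ : Disjoint (C ∪ X \ C) (Y \ C) := by
    rw [Finset.disjoint_left]
    intro v hv hv'
    rw [Finset.mem_sdiff, hpart] at hv'
    simp only [Finset.mem_union, Finset.mem_sdiff] at hv
    tauto
  have huniv : (Finset.univ : Finset V) = (C ∪ X \ C) ∪ Y \ C := by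
    ext v
    have := hpart v
    simp only [Finset.mem_univ, Finset.mem_union, Finset.mem_sdiff, this]
    tauto
  have hsplit : ∀ d : V → ℕ, ∑ v, d v = ∑ v ∈ C, d v + ∑ v ∈ X \ C, d v + ∑ v ∈ Y \ C, d v := by
    intro d
    rw [huniv, Finset.sum_union hd₂, Finset.sum_union hd₁]
  have hdeg : ∀ v, G.degree v = (C.filter fun w => G.Adj v w).card +
      ((X \ C).filter fun w => G.Adj v w).card + ((Y \ C).filter fun w => G.Adj v w).card := by
    intro v
    rw [← G.card_neighborFinset_eq_degree, neighborFinset_eq_filter, Finset.card_filter, hsplit]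
    simp only [Finset.card_filter]
  have hz₁ : ∑ v ∈ X \ C, ((X \ C).filter fun w => G.Adj v w).card = 0 := by
    refine Finset.sum_eq_zero fun v hv => ?_
    rw [Finset.card_eq_zero, Finset.filter_eq_empty_iff]
    intro w hw hvw
    rw [Finset.mem_sdiff] at hv hw
    exact (hb _ _ hvw).1 hv.1 hw.1
  have hz₂ : ∑ v ∈ Y \ C, ((Y \ C).filter fun w => G.Adj v w).card = 0 := by
    refine Finset.sum_eq_zero fun v hv => ?_
    rw [Finset.card_eq_zero, Finset.filter_eq_empty_iff]
    intro w hw hvw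
    rw [Finset.mem_sdiff, hpart] at hv hw
    exact hv.1 ((hb _ _ hvw).2 hw.1)
  have hE := G.sum_degrees_eq_twice_card_edges
  rw [hsplit] at hE
  simp only [hdeg, Finset.sum_add_distrib, hz₁, hz₂] at hE
  have c1 := sum_card_filter_adj_comm (G := G) C (X \ C)
  have c2 := sum_card_filter_adj_comm (G := G) C (Y \ C)
  have c3 := sum_card_filter_adj_comm (G := G) (Y \ C) (X \ C)
  have hcard : G.edgeSet.ncard = G.edgeFinset.card := by
    rw [← coe_edgeFinset, Set.ncard_coe_finset]
  simp only [← hCd] at hin hout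
  obtain ⟨r, rfl⟩ : ∃ r, n = m + r := ⟨n - m, by omega⟩
  rw [show m + r - m = r by omega] at hout
  have e1 : (m + r) * (m + r + 1) = m * (m + 1) + (2 * (r * m) + r * r + r) := by ring
  rw [hcard, e1]
  omega

end SimpleGraph


/-- **Theorem (Li–Ning, balanced case, part (ii)).** Let `G` be a balanced bipartite graph of
order `2n` with `n ≥ 2k+2`. If `e(G) ≥ (n-k-1)n + k + 2`, then `G` contains cycles of all
even lengths from `4` up to its circumference: for every `ℓ ≥ 2`, if `G` has a cycle of
length at least `2ℓ` (i.e. `2ℓ ≤ c(G)`), then `G` has a cycle of length exactly `2ℓ`. -/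
theorem stmt_5 {V : Type} [Fintype V] [DecidableEq V]
    (G : SimpleGraph V) (X Y : Finset V) (n k : ℕ)
    (hpart : ∀ v : V, v ∈ X ∨ v ∈ Y) (hdisj : Disjoint X Y)
    (hbip : ∀ u v : V, G.Adj u v → (u ∈ X ∧ v ∈ Y) ∨ (u ∈ Y ∧ v ∈ X))
    (hX : X.card = n) (hY : Y.card = n)
    (hnk : 2 * k + 2 ≤ n)
    (he : (n - k - 1) * n + k + 2 ≤ G.edgeSet.ncard) :
    ∀ ℓ : ℕ, 2 ≤ ℓ →
      (∃ (v : V) (w : G.Walk v v), w.IsCycle ∧ 2 * ℓ ≤ w.length) →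
      ∃ (v : V) (w : G.Walk v v), w.IsCycle ∧ w.length = 2 * ℓ := by
  classical
  intro ℓ hℓ ⟨v, w, hw, hwℓ⟩
  by_contra hnot
  have hpart' : ∀ v, v ∈ Y ↔ v ∉ X := fun v =>
    ⟨fun h h' => Finset.disjoint_left.1 hdisj h' h, fun h => (hpart v).resolve_left h⟩
  have hb : ∀ u v, G.Adj u v → (u ∈ X ↔ v ∉ X) := by
    intro u v huv
    have h1 := hbip u v huv
    rw [hpart' u, hpart' v] at h1
    tauto
  have hno : ∀ f, ¬ G.IsCyclicSeq f (2 * ℓ) := fun f hf => hnot (hf.exists_isCycle (by omega))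
  let P : ℕ → Prop := fun N => ∃ f, G.IsCyclicSeq f N
  have hbound : ∀ N, P N → N ≤ Fintype.card V := by
    rintro N ⟨f, hf⟩
    rw [← hf.card_image]
    exact Finset.card_le_univ _
  have hP := hw.exists_isCyclicSeq
  obtain ⟨f, hf⟩ := Nat.findGreatest_spec (P := P) (hbound _ hP) hP
  have hle := Nat.le_findGreatest (P := P) (hbound _ hP) hP
  have hmax : ∀ g N, G.IsCyclicSeq g N → N ≤ Nat.findGreatest P (Fintype.card V) :=
    fun g N hg => Nat.le_findGreatest (hbound _ ⟨g, hg⟩) ⟨g, hg⟩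
  have heven := hf.even (X := (X : Set V)) (by simpa using hb)
  obtain ⟨m, hm⟩ : ∃ m, Nat.findGreatest P (Fintype.card V) = 2 * m :=
    ⟨Nat.findGreatest P (Fintype.card V) / 2, by omega⟩
  rw [hm] at hf hle hmax
  have hℓm : ℓ < m := by
    refine lt_of_le_of_ne (by omega) ?_
    rintro rfl
    exact hno f hf
  have hcard := hf.two_mul_ncard_edgeSet_le hpart' hX hY hb hmax hℓ hℓm hno
  obtain ⟨j, rfl⟩ := Nat.exists_eq_add_of_le hnk
  rw [show 2 * k + 2 + j - k - 1 = k + 1 + j by omega] at he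
  nlinarith [Nat.zero_le (j * k), Nat.zero_le (j * j)]
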